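/- Let K be a field with char K ∉ {2,3} and let t ∈ K with t³ ≠ −1. Consider the Weierstrass curve W over K given by y² = x³ − 3t(t³ − 8)x − 2(t⁶ + 20t³ − 8). Then W has nonzero discriminant and its j-invariant equals −27·t³·(t³ − 8)³/(t³ + 1)³. -/

import Mathlib

/-- A prime different from the characteristic of a field is nonzero in it. -/
lemma natCast_ne_zero_of_ringChar_ne {K : Type*} [Field K] {p : ℕ} (hp : p.Prime)
    (h : ringChar K ≠ p) : (p : K) ≠ 0 := fun h0 =>
  h <| (hp.eq_one_or_self_of_dvd _ (ringChar.dvd h0)).resolve_left CharP.ringChar_ne_one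

/-- The Weierstrass model of the Hesse curve `E_t` has nonzero
discriminant and j-invariant `−27t³(t³−8)³/(t³+1)³`. -/
theorem stmt_16 (K : Type*) [Field K]
    (hchar2 : ringChar K ≠ 2) (hchar3 : ringChar K ≠ 3)
    (t : K) (ht : t ^ 3 ≠ -1)
    (W : WeierstrassCurve K)
    (hW : W = ⟨0, 0, 0, -(3 * t * (t ^ 3 - 8)), -(2 * (t ^ 6 + 20 * t ^ 3 - 8))⟩) :
    W.Δ ≠ 0 ∧ ∃ hE : W.IsElliptic, @WeierstrassCurve.j K _ W hE =
      -(27 * t ^ 3 * (t ^ 3 - 8) ^ 3) / (t ^ 3 + 1) ^ 3 := by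
  have h2 : (2 : K) ≠ 0 := mod_cast natCast_ne_zero_of_ringChar_ne Nat.prime_two hchar2
  have h3 : (3 : K) ≠ 0 := mod_cast natCast_ne_zero_of_ringChar_ne Nat.prime_three hchar3
  have ht' : t ^ 3 + 1 ≠ 0 := fun h => ht (eq_neg_of_add_eq_zero_left h)
  have hΔ : W.Δ = -(2 ^ 12 * 3 ^ 3 * (t ^ 3 + 1) ^ 3) := by
    subst hW
    simp only [WeierstrassCurve.Δ, WeierstrassCurve.b₂, WeierstrassCurve.b₄,
      WeierstrassCurve.b₆, WeierstrassCurve.b₈]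
    ring
  have hc₄ : W.c₄ = 2 ^ 4 * 3 ^ 2 * t * (t ^ 3 - 8) := by
    subst hW
    simp only [WeierstrassCurve.c₄, WeierstrassCurve.b₂, WeierstrassCurve.b₄]
    ring
  have hΔ0 : W.Δ ≠ 0 := by
    rw [hΔ]
    exact neg_ne_zero.mpr (mul_ne_zero (mul_ne_zero (pow_ne_zero _ h2) (pow_ne_zero _ h3))
      (pow_ne_zero _ ht'))
  have hE : W.IsElliptic := ⟨hΔ0.isUnit⟩
  refine ⟨hΔ0, hE, ?_⟩
  rw [WeierstrassCurve.j, Units.val_inv_eq_inv_val, WeierstrassCurve.coe_Δ',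
    inv_mul_eq_div, div_eq_div_iff hΔ0 (pow_ne_zero _ ht'), hΔ, hc₄]
  ring
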